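/- Reduction: If Γ ⊢ φ (φ is provable from Γ in NBQL_CD^r), then there exists n ∈ ℕ such that Γ ⊢_{[-1]} □ⁿφ (□ⁿφ is provable from Γ in NBQL_CD). -/

import Mathlib

universe u v

namespace BQL

structure Signature : Type 1 where
  Const : Type
  Func : Type
  arityF : Func → ℕ
  Rel : Type
  arityR : Rel → ℕ

inductive Term (L : Signature) : Type
  | var : ℕ → Term L
  | const : L.Const → Term L
  | func : (f : L.Func) → (Fin (L.arityF f) → Term L) → Term L

inductive Formula (L : Signature) : Type
  | top : Formula L
  | bot : Formula L
  | rel : (R : L.Rel) → (Fin (L.arityR R) → Term L) → Formula L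
  | and : Formula L → Formula L → Formula L
  | or : Formula L → Formula L → Formula L
  | imp : Formula L → Formula L → Formula L
  | all : Formula L → Formula L
  | ex : Formula L → Formula L

variable {L : Signature}

namespace Term

/-- Shift all (free) variables of a term up by one. -/
def shiftUp : Term L → Term L
  | var n => var (n + 1)
  | const c => const c
  | func f ts => func f fun i => (ts i).shiftUp

/-- Apply a simultaneous substitution to a term. -/
def applySub (σ : ℕ → Term L) : Term L → Term L
  | var n => σ n
  | const c => const c
  | func f ts => func f fun i => (ts i).applySub σ

/-- All variables of the term are `< k`. -/
def ClosedAt : Term L → ℕ → Prop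
  | var n, k => n < k
  | const _, _ => True
  | func _ ts, k => ∀ i, (ts i).ClosedAt k

/-- A closed term. -/
def Closed (t : Term L) : Prop := t.ClosedAt 0

/-- The constant `c` occurs in the term. -/
def OccC (c : L.Const) : Term L → Prop
  | var _ => False
  | const d => d = c
  | func _ ts => ∃ i, (ts i).OccC c

end Term

/-- Lift a substitution under a binder. -/
def liftSub (σ : ℕ → Term L) : ℕ → Term L
  | 0 => .var 0
  | n + 1 => (σ n).shiftUp

namespace Formula

/-- Apply a simultaneous substitution to a formula. -/
def applySub (σ : ℕ → Term L) : Formula L → Formula L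
  | top => top
  | bot => bot
  | rel R ts => rel R fun i => (ts i).applySub σ
  | and φ ψ => and (φ.applySub σ) (ψ.applySub σ)
  | or φ ψ => or (φ.applySub σ) (ψ.applySub σ)
  | imp φ ψ => imp (φ.applySub σ) (ψ.applySub σ)
  | all φ => all (φ.applySub (liftSub σ))
  | ex φ => ex (φ.applySub (liftSub σ))

/-- All free variables of the formula are `< k`. -/
def ClosedAt : Formula L → ℕ → Prop
  | top, _ => True
  | bot, _ => True
  | rel _ ts, k => ∀ i, (ts i).ClosedAt k
  | and φ ψ, k => φ.ClosedAt k ∧ ψ.ClosedAt k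
  | or φ ψ, k => φ.ClosedAt k ∧ ψ.ClosedAt k
  | imp φ ψ, k => φ.ClosedAt k ∧ ψ.ClosedAt k
  | all φ, k => φ.ClosedAt (k + 1)
  | ex φ, k => φ.ClosedAt (k + 1)

/-- A sentence: a formula with no free variables. -/
def Sentence (φ : Formula L) : Prop := φ.ClosedAt 0

/-- The constant `c` occurs in the formula. -/
def OccC (c : L.Const) : Formula L → Prop
  | top => False
  | bot => False
  | rel _ ts => ∃ i, (ts i).OccC c
  | and φ ψ => φ.OccC c ∨ ψ.OccC c
  | or φ ψ => φ.OccC c ∨ ψ.OccC c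
  | imp φ ψ => φ.OccC c ∨ ψ.OccC c
  | all φ => φ.OccC c
  | ex φ => φ.OccC c

/-- The formula contains no occurrence of `∨` and no occurrence of `∃`. -/
def NoOrEx : Formula L → Prop
  | top => True
  | bot => True
  | rel _ _ => True
  | and φ ψ => φ.NoOrEx ∧ ψ.NoOrEx
  | or _ _ => False
  | imp φ ψ => φ.NoOrEx ∧ ψ.NoOrEx
  | all φ => φ.NoOrEx
  | ex _ => False

end Formula

/-- Substitute the term `t` for the variable `v₀` (lowering the other variables). -/
def subst0 (φ : Formula L) (t : Term L) : Formula L :=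
  φ.applySub fun n => match n with | 0 => t | n + 1 => .var n

/-- `□ⁿφ`, where `□φ` abbreviates `⊤ → φ`. -/
def boxN : ℕ → Formula L → Formula L
  | 0, φ => φ
  | n + 1, φ => .imp .top (boxN n φ)

/-- The conjunction of a finite list of formulas (`⋀∅ = ⊤`). -/
def conjL : List (Formula L) → Formula L
  | [] => .top
  | [φ] => φ
  | φ :: ψ :: l => .and φ (conjL (ψ :: l))

/-- The language `L⁺`, obtained from `L` by adding countably many fresh constants `aᵢ`. -/
def Signature.plus (L : Signature) : Signature where
  Const := L.Const ⊕ ℕ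
  Func := L.Func
  arityF := L.arityF
  Rel := L.Rel
  arityR := L.arityR

/-- The fresh constant `aᵢ` of `L⁺`. -/
def aconst (L : Signature) (i : ℕ) : Term L.plus := .const (Sum.inr i)

/-- Embedding of `L`-terms into `L⁺`-terms. -/
def Term.emb : Term L → Term L.plus
  | .var n => .var n
  | .const c => .const (Sum.inl c)
  | .func f ts => .func f fun i => (ts i).emb

/-- Embedding of `L`-formulas into `L⁺`-formulas. -/
def Formula.emb : Formula L → Formula L.plus
  | .top => .top
  | .bot => .bot
  | .rel R ts => .rel R fun i => (ts i).emb
  | .and φ ψ => .and φ.emb ψ.emb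
  | .or φ ψ => .or φ.emb ψ.emb
  | .imp φ ψ => .imp φ.emb ψ.emb
  | .all φ => .all φ.emb
  | .ex φ => .ex φ.emb

/-- The fresh constant `aᵢ` occurs in no member of `Γ`. -/
def FreshIn (i : ℕ) (Γ : Set (Formula L.plus)) : Prop :=
  ∀ ψ ∈ Γ, ¬ ψ.OccC (Sum.inr i)

/-- A Kripke `L`-model (the frame conditions are packaged in `KModel.Proper`). -/
structure KModel (L : Signature) : Type (u + 1) where
  W : Type u
  acc : W → W → Prop
  D : Type u
  interpC : L.Const → D
  interpF : (f : L.Func) → (Fin (L.arityF f) → D) → D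
  interpR : (R : L.Rel) → W → Set (Fin (L.arityR R) → D)

/-- The conditions on an `L`-model: nonempty set of worlds, transitive accessibility
relation, nonempty domain, and the persistence constraint. -/
def KModel.Proper (M : KModel.{u} L) : Prop :=
  Nonempty M.W ∧ Nonempty M.D ∧ Transitive M.acc ∧
    ∀ (R : L.Rel) (w u' : M.W), M.acc w u' → M.interpR R w ⊆ M.interpR R u'

/-- Prepend a value to a valuation. -/
def vcons {α : Sort*} (d : α) (ρ : ℕ → α) : ℕ → α
  | 0 => d
  | n + 1 => ρ n

/-- Denotation of a term. -/
def Term.eval (M : KModel.{u} L) (ρ : ℕ → M.D) : Term L → M.D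
  | .var n => ρ n
  | .const c => M.interpC c
  | .func f ts => M.interpF f fun i => (ts i).eval M ρ

/-- The satisfaction relation `w ⊩ φ(ā)`. -/
def Sat (M : KModel.{u} L) : M.W → (ℕ → M.D) → Formula L → Prop
  | _, _, .top => True
  | _, _, .bot => False
  | w, ρ, .rel R ts => (fun i => (ts i).eval M ρ) ∈ M.interpR R w
  | w, ρ, .and φ ψ => Sat M w ρ φ ∧ Sat M w ρ ψ
  | w, ρ, .or φ ψ => Sat M w ρ φ ∨ Sat M w ρ ψ
  | w, ρ, .imp φ ψ => ∀ u', M.acc w u' → Sat M u' ρ φ → Sat M u' ρ ψ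
  | w, ρ, .all φ => ∀ d, Sat M w (vcons d ρ) φ
  | w, ρ, .ex φ => ∃ d, Sat M w (vcons d ρ) φ

/-- Satisfaction of a sentence (under every valuation). -/
def SatS (M : KModel.{u} L) (w : M.W) (φ : Formula L) : Prop := ∀ ρ, Sat M w ρ φ

/-- `Γ ⊨ φ`: truth is preserved at every reflexive world of every `L`-model. -/
def Models (Γ : Set (Formula L)) (φ : Formula L) : Prop :=
  ∀ M : KModel.{u} L, M.Proper → ∀ w : M.W, M.acc w w →
    (∀ ψ ∈ Γ, SatS M w ψ) → SatS M w φ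

/-- `Γ : Δ ⊨ φ`: for every `L`-model, every reflexive world `w` and every world `u ≻ w`:
if `w ⊩ Γ` and `u ⊩ Δ` then `u ⊩ φ`. -/
def ModelsCtx (Γ Δ : Set (Formula L)) (φ : Formula L) : Prop :=
  ∀ M : KModel.{u} L, M.Proper → ∀ w u' : M.W, M.acc w w → M.acc w u' →
    (∀ ψ ∈ Γ, SatS M w ψ) → (∀ ψ ∈ Δ, SatS M u' ψ) → SatS M u' φ

end BQL

namespace BQL

/-- `Prf L Γ Δ φ` formalizes `Γ : Δ ⊢ φ`: there is a proof of `φ` in the natural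
deduction system `NBQL_CD^r` (over `L⁺`-sentences) whose open assumptions all belong
to `Γ ∪ Δ` and in which every open assumption occurring *unsafely* (i.e. in the right
main subproof of an application of `→`-Elim) belongs to `Γ`.  Assumptions may be
discharged only at safe occurrences, so discharge always happens in the `Δ` zone. -/
inductive Prf (L : Signature) :
    Set (Formula L.plus) → Set (Formula L.plus) → Formula L.plus → Prop
  | hyp {Γ Δ : Set (Formula L.plus)} {φ} : φ ∈ Γ ∪ Δ → φ.Sentence → Prf L Γ Δ φ
  | weaken {Γ Γ' Δ Δ' φ} : Γ ⊆ Γ' → Δ ⊆ Δ' → Prf L Γ Δ φ → Prf L Γ' Δ' φ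
  | topIntro {Γ Δ} : Prf L Γ Δ .top
  | botElim {Γ Δ φ} : φ.Sentence → Prf L Γ Δ .bot → Prf L Γ Δ φ
  | andIntro {Γ Δ φ ψ} : Prf L Γ Δ φ → Prf L Γ Δ ψ → Prf L Γ Δ (.and φ ψ)
  | andElimL {Γ Δ φ ψ} : Prf L Γ Δ (.and φ ψ) → Prf L Γ Δ φ
  | andElimR {Γ Δ φ ψ} : Prf L Γ Δ (.and φ ψ) → Prf L Γ Δ ψ
  | orIntroL {Γ Δ φ ψ} : ψ.Sentence → Prf L Γ Δ φ → Prf L Γ Δ (.or φ ψ)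
  | orIntroR {Γ Δ φ ψ} : φ.Sentence → Prf L Γ Δ ψ → Prf L Γ Δ (.or φ ψ)
  | orElim {Γ Δ φ ψ χ} : Prf L Γ Δ (.or φ ψ) → Prf L Γ (insert φ Δ) χ →
      Prf L Γ (insert ψ Δ) χ → Prf L Γ Δ χ
  | impIntro {Γ Δ φ ψ} : φ.Sentence → Prf L Γ (insert φ Δ) ψ → Prf L Γ Δ (.imp φ ψ)
  | impElim {Γ Δ φ ψ} : Prf L Γ Δ φ → Prf L Γ ∅ (.imp φ ψ) → Prf L Γ Δ ψ
  | intTrans {Γ Δ φ ψ χ} : Prf L Γ Δ (.imp φ ψ) → Prf L Γ Δ (.imp ψ χ) →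
      Prf L Γ Δ (.imp φ χ)
  | intAndIntro {Γ Δ φ ψ χ} : Prf L Γ Δ (.imp φ ψ) → Prf L Γ Δ (.imp φ χ) →
      Prf L Γ Δ (.imp φ (.and ψ χ))
  | intOrElim {Γ Δ φ ψ χ} : Prf L Γ Δ (.imp φ χ) → Prf L Γ Δ (.imp ψ χ) →
      Prf L Γ Δ (.imp (.or φ ψ) χ)
  | intAllIntro {Γ Δ φ ψ} : φ.Sentence → Prf L Γ Δ (.all (.imp φ ψ)) →
      Prf L Γ Δ (.imp φ (.all ψ))
  | intExElim {Γ Δ φ ψ} : ψ.Sentence → Prf L Γ Δ (.all (.imp φ ψ)) →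
      Prf L Γ Δ (.imp (.ex φ) ψ)
  | allIntro {Γ Δ Γ' Δ' φ} {i : ℕ} : Γ' ⊆ Γ → Δ' ⊆ Δ → FreshIn i Γ' → FreshIn i Δ' →
      ¬ φ.OccC (Sum.inr i) → Prf L Γ' Δ' (subst0 φ (aconst L i)) → Prf L Γ Δ (.all φ)
  | allElim {Γ Δ φ} {t : Term L.plus} : t.Closed → Prf L Γ Δ (.all φ) →
      Prf L Γ Δ (subst0 φ t)
  | cd {Γ Δ φ ψ} : φ.Sentence → Prf L Γ Δ (.all (.or φ ψ)) → Prf L Γ Δ (.or φ (.all ψ))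
  | exIntro {Γ Δ φ} {t : Term L.plus} : t.Closed → (Formula.ex φ).Sentence →
      Prf L Γ Δ (subst0 φ t) → Prf L Γ Δ (.ex φ)
  | exElim {Γ Δ Γ' Δ' φ ψ} {i : ℕ} : Γ' ⊆ Γ → Δ' ⊆ Δ → FreshIn i Γ' → FreshIn i Δ' →
      ¬ φ.OccC (Sum.inr i) → ¬ ψ.OccC (Sum.inr i) → Prf L Γ Δ (.ex φ) →
      Prf L Γ' (insert (subst0 φ (aconst L i)) Δ') ψ → Prf L Γ Δ ψ

/-- `Γ ⊢ φ`: there is a proof of `φ` from `Γ` in `NBQL_CD^r`. -/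
def Prv (L : Signature) (Γ : Set (Formula L.plus)) (φ : Formula L.plus) : Prop :=
  Prf L Γ ∅ φ

end BQL

namespace BQL

/-- `PrfN L n Γ Δ φ` formalizes `Γ : Δ ⊢_{[n-1]} φ`: there is a proof of `φ` in the
system `NBQL_CD[n-1]` (so `PrfN L 0` is the system `NBQL_CD`, i.e. `⊢_{[-1]}`, which
has no modus ponens at all) whose open assumptions all belong to `Γ ∪ Δ` and in which
every open assumption occurring unsafely (i.e. in the right main subproof of an
application of the restricted modus ponens rule) belongs to `Γ`.  The restricted
modus ponens rule of `NBQL_CD[n-1]` requires its right main subproof to lie entirely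
within `NBQL_CD[m-1]` for some `m < n`. -/
inductive PrfN (L : Signature) :
    ℕ → Set (Formula L.plus) → Set (Formula L.plus) → Formula L.plus → Prop
  | hyp {n Γ Δ φ} : φ ∈ Γ ∪ Δ → φ.Sentence → PrfN L n Γ Δ φ
  | weaken {n Γ Γ' Δ Δ' φ} : Γ ⊆ Γ' → Δ ⊆ Δ' → PrfN L n Γ Δ φ → PrfN L n Γ' Δ' φ
  | topIntro {n Γ Δ} : PrfN L n Γ Δ .top
  | botElim {n Γ Δ φ} : φ.Sentence → PrfN L n Γ Δ .bot → PrfN L n Γ Δ φ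
  | andIntro {n Γ Δ φ ψ} : PrfN L n Γ Δ φ → PrfN L n Γ Δ ψ → PrfN L n Γ Δ (.and φ ψ)
  | andElimL {n Γ Δ φ ψ} : PrfN L n Γ Δ (.and φ ψ) → PrfN L n Γ Δ φ
  | andElimR {n Γ Δ φ ψ} : PrfN L n Γ Δ (.and φ ψ) → PrfN L n Γ Δ ψ
  | orIntroL {n Γ Δ φ ψ} : ψ.Sentence → PrfN L n Γ Δ φ → PrfN L n Γ Δ (.or φ ψ)
  | orIntroR {n Γ Δ φ ψ} : φ.Sentence → PrfN L n Γ Δ ψ → PrfN L n Γ Δ (.or φ ψ)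
  | orElim {n Γ Δ φ ψ χ} : PrfN L n Γ Δ (.or φ ψ) → PrfN L n Γ (insert φ Δ) χ →
      PrfN L n Γ (insert ψ Δ) χ → PrfN L n Γ Δ χ
  | impIntro {n Γ Δ φ ψ} : φ.Sentence → PrfN L n Γ (insert φ Δ) ψ →
      PrfN L n Γ Δ (.imp φ ψ)
  | impElim {n m Γ Δ φ ψ} : m < n → PrfN L n Γ Δ φ → PrfN L m Γ ∅ (.imp φ ψ) →
      PrfN L n Γ Δ ψ
  | intTrans {n Γ Δ φ ψ χ} : PrfN L n Γ Δ (.imp φ ψ) → PrfN L n Γ Δ (.imp ψ χ) →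
      PrfN L n Γ Δ (.imp φ χ)
  | intAndIntro {n Γ Δ φ ψ χ} : PrfN L n Γ Δ (.imp φ ψ) → PrfN L n Γ Δ (.imp φ χ) →
      PrfN L n Γ Δ (.imp φ (.and ψ χ))
  | intOrElim {n Γ Δ φ ψ χ} : PrfN L n Γ Δ (.imp φ χ) → PrfN L n Γ Δ (.imp ψ χ) →
      PrfN L n Γ Δ (.imp (.or φ ψ) χ)
  | intAllIntro {n Γ Δ φ ψ} : φ.Sentence → PrfN L n Γ Δ (.all (.imp φ ψ)) →
      PrfN L n Γ Δ (.imp φ (.all ψ))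
  | intExElim {n Γ Δ φ ψ} : ψ.Sentence → PrfN L n Γ Δ (.all (.imp φ ψ)) →
      PrfN L n Γ Δ (.imp (.ex φ) ψ)
  | allIntro {n Γ Δ Γ' Δ' φ} {i : ℕ} : Γ' ⊆ Γ → Δ' ⊆ Δ → FreshIn i Γ' → FreshIn i Δ' →
      ¬ φ.OccC (Sum.inr i) → PrfN L n Γ' Δ' (subst0 φ (aconst L i)) →
      PrfN L n Γ Δ (.all φ)
  | allElim {n Γ Δ φ} {t : Term L.plus} : t.Closed → PrfN L n Γ Δ (.all φ) →
      PrfN L n Γ Δ (subst0 φ t)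
  | cd {n Γ Δ φ ψ} : φ.Sentence → PrfN L n Γ Δ (.all (.or φ ψ)) →
      PrfN L n Γ Δ (.or φ (.all ψ))
  | exIntro {n Γ Δ φ} {t : Term L.plus} : t.Closed → (Formula.ex φ).Sentence →
      PrfN L n Γ Δ (subst0 φ t) → PrfN L n Γ Δ (.ex φ)
  | exElim {n Γ Δ Γ' Δ' φ ψ} {i : ℕ} : Γ' ⊆ Γ → Δ' ⊆ Δ → FreshIn i Γ' → FreshIn i Δ' →
      ¬ φ.OccC (Sum.inr i) → ¬ ψ.OccC (Sum.inr i) → PrfN L n Γ Δ (.ex φ) →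
      PrfN L n Γ' (insert (subst0 φ (aconst L i)) Δ') ψ → PrfN L n Γ Δ ψ

/-- `Γ ⊢_{[-1]} φ`: there is a proof of `φ` from `Γ` in `NBQL_CD`
(the system `NBQL_CD^r` with `→`-Elim deleted). -/
def PrvB (L : Signature) (Γ : Set (Formula L.plus)) (φ : Formula L.plus) : Prop :=
  PrfN L 0 Γ ∅ φ

end BQL

namespace BQL

section Reduction

variable {L : Signature}

theorem Term.applySub_eq_self {σ : ℕ → Term L} {t : Term L} {k : ℕ} (ht : t.ClosedAt k)
    (hσ : ∀ j < k, σ j = .var j) : t.applySub σ = t := by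
  induction t with
  | var n => exact hσ n ht
  | const c => rfl
  | func f ts ih => simp only [Term.applySub]; congr; funext i; exact ih i (ht i)

theorem Formula.applySub_eq_self {φ : Formula L} {σ : ℕ → Term L} {k : ℕ} (hφ : φ.ClosedAt k)
    (hσ : ∀ j < k, σ j = .var j) : φ.applySub σ = φ := by
  have lift {σ : ℕ → Term L} {k : ℕ} (hσ : ∀ j < k, σ j = .var j) :
      ∀ j < k + 1, liftSub σ j = .var j := by
    rintro (_ | j) hj
    · rfl
    · simp [liftSub, hσ j (by omega), Term.shiftUp]
  induction φ generalizing σ k with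
  | top => rfl
  | bot => rfl
  | rel R ts =>
    simp only [Formula.applySub]; congr; funext i; exact Term.applySub_eq_self (hφ i) hσ
  | and φ ψ ihφ ihψ => simp [Formula.applySub, ihφ hφ.1 hσ, ihψ hφ.2 hσ]
  | or φ ψ ihφ ihψ => simp [Formula.applySub, ihφ hφ.1 hσ, ihψ hφ.2 hσ]
  | imp φ ψ ihφ ihψ => simp [Formula.applySub, ihφ hφ.1 hσ, ihψ hφ.2 hσ]
  | all φ ih => simp [Formula.applySub, ih hφ (lift hσ)]
  | ex φ ih => simp [Formula.applySub, ih hφ (lift hσ)]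

theorem subst0_eq_self {φ : Formula L} (hφ : φ.Sentence) (t : Term L) : subst0 φ t = φ :=
  Formula.applySub_eq_self hφ (by simp)

theorem Term.closedAt_shiftUp {t : Term L} {k : ℕ} :
    t.shiftUp.ClosedAt (k + 1) ↔ t.ClosedAt k := by
  induction t with
  | var n => simp [Term.shiftUp, Term.ClosedAt]
  | const c => simp [Term.shiftUp, Term.ClosedAt]
  | func f ts ih => simp [Term.shiftUp, Term.ClosedAt, ih]

theorem Term.closedAt_applySub {σ : ℕ → Term L} {t : Term L} {k m : ℕ}
    (hσ : ∀ j, (σ j).ClosedAt m ↔ j < k) : (t.applySub σ).ClosedAt m ↔ t.ClosedAt k := by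
  induction t with
  | var n => exact hσ n
  | const c => rfl
  | func f ts ih => simp [Term.applySub, Term.ClosedAt, ih]

theorem Formula.closedAt_applySub {φ : Formula L} {σ : ℕ → Term L} {k m : ℕ}
    (hσ : ∀ j, (σ j).ClosedAt m ↔ j < k) : (φ.applySub σ).ClosedAt m ↔ φ.ClosedAt k := by
  have lift {σ : ℕ → Term L} {k m : ℕ} (hσ : ∀ j, (σ j).ClosedAt m ↔ j < k) :
      ∀ j, (liftSub σ j).ClosedAt (m + 1) ↔ j < k + 1 := by
    rintro (_ | j)
    · simp [liftSub, Term.ClosedAt]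
    · simp [liftSub, Term.closedAt_shiftUp, hσ]
  induction φ generalizing σ k m with
  | top => rfl
  | bot => rfl
  | rel R ts => simp [Formula.applySub, Formula.ClosedAt, Term.closedAt_applySub hσ]
  | and φ ψ ihφ ihψ => simp [Formula.applySub, Formula.ClosedAt, ihφ hσ, ihψ hσ]
  | or φ ψ ihφ ihψ => simp [Formula.applySub, Formula.ClosedAt, ihφ hσ, ihψ hσ]
  | imp φ ψ ihφ ihψ => simp [Formula.applySub, Formula.ClosedAt, ihφ hσ, ihψ hσ]
  | all φ ih => exact ih (lift hσ)
  | ex φ ih => exact ih (lift hσ)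

theorem subst0_sentence {φ : Formula L} {t : Term L} (ht : t.Closed) :
    (subst0 φ t).Sentence ↔ φ.ClosedAt 1 := by
  refine Formula.closedAt_applySub ?_
  rintro (_ | j)
  · exact iff_of_true ht zero_lt_one
  · simp [Term.ClosedAt]

theorem aconst_closed (i : ℕ) : (aconst L i).Closed := trivial

@[simp] theorem sentence_imp {φ ψ : Formula L} :
    (Formula.imp φ ψ).Sentence ↔ φ.Sentence ∧ ψ.Sentence := Iff.rfl

@[simp] theorem sentence_and {φ ψ : Formula L} :
    (Formula.and φ ψ).Sentence ↔ φ.Sentence ∧ ψ.Sentence := Iff.rfl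

@[simp] theorem sentence_or {φ ψ : Formula L} :
    (Formula.or φ ψ).Sentence ↔ φ.Sentence ∧ ψ.Sentence := Iff.rfl

@[simp] theorem sentence_top : (Formula.top : Formula L).Sentence := trivial

@[simp] theorem sentence_boxN {φ : Formula L} {n : ℕ} :
    (boxN n φ).Sentence ↔ φ.Sentence := by
  induction n with
  | zero => rfl
  | succ n ih => simp [boxN, ih]

theorem occC_boxN {φ : Formula L} {n : ℕ} {c : L.Const} :
    (boxN n φ).OccC c ↔ φ.OccC c := by
  induction n with
  | zero => rfl
  | succ n ih => simp [boxN, Formula.OccC, ih]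

theorem subst0_boxN {φ : Formula L} {n : ℕ} {t : Term L} :
    subst0 (boxN n φ) t = boxN n (subst0 φ t) := by
  induction n with
  | zero => rfl
  | succ n ih => exact congrArg (Formula.imp .top) ih

theorem boxN_succ' (n : ℕ) (φ : Formula L) : boxN (n + 1) φ = boxN n (.imp .top φ) := by
  induction n with
  | zero => rfl
  | succ n ih => exact congrArg (Formula.imp .top) ih

theorem PrfN.sentence {n : ℕ} {Γ Δ : Set (Formula L.plus)} {φ : Formula L.plus}
    (h : PrfN L n Γ Δ φ) : φ.Sentence := by
  induction h with
  | hyp _ h => exact h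
  | weaken _ _ _ ih => exact ih
  | topIntro => trivial
  | botElim h => exact h
  | andIntro _ _ ih₁ ih₂ => exact ⟨ih₁, ih₂⟩
  | andElimL _ ih => exact ih.1
  | andElimR _ ih => exact ih.2
  | orIntroL h _ ih => exact ⟨ih, h⟩
  | orIntroR h _ ih => exact ⟨h, ih⟩
  | orElim _ _ _ _ ih => exact ih
  | impIntro h _ ih => exact ⟨h, ih⟩
  | impElim _ _ _ _ ih => exact ih.2
  | intTrans _ _ ih₁ ih₂ => exact ⟨ih₁.1, ih₂.2⟩
  | intAndIntro _ _ ih₁ ih₂ => exact ⟨ih₁.1, ih₁.2, ih₂.2⟩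
  | intOrElim _ _ ih₁ ih₂ => exact ⟨⟨ih₁.1, ih₂.1⟩, ih₁.2⟩
  | intAllIntro h _ ih => exact ⟨h, ih.2⟩
  | intExElim h _ ih => exact ⟨ih.1, h⟩
  | allIntro _ _ _ _ _ _ ih => exact (subst0_sentence (aconst_closed _)).1 ih
  | allElim ht _ ih => exact (subst0_sentence ht).2 ih
  | cd h _ ih => exact ⟨h, ih.2⟩
  | exIntro _ h => exact h
  | exElim _ _ _ _ _ _ _ _ _ ih => exact ih

section Calculus

variable {Γ Δ : Set (Formula L.plus)} {φ ψ χ : Formula L.plus}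

theorem PrfN.self (hφ : φ.Sentence) : PrfN L 0 ∅ {φ} φ := .hyp (by simp) hφ

theorem PrfN.cut (h : PrfN L 0 Γ Δ φ) (h' : PrfN L 0 ∅ {φ} ψ) : PrfN L 0 Γ Δ ψ := by
  have h'' : PrfN L 0 Γ (insert φ Δ) ψ := h'.weaken (Set.empty_subset _) (by simp)
  exact (PrfN.orIntroL h.sentence h).orElim h'' h''

theorem PrfN.imp_of (hφ : φ.Sentence) (h : PrfN L 0 ∅ {φ} ψ) : PrfN L 0 Γ Δ (.imp φ ψ) :=
  .impIntro hφ (h.weaken (Set.empty_subset _) (by simp))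

theorem PrfN.box_map {n : ℕ} (h : PrfN L 0 Γ Δ (boxN n φ)) (h' : PrfN L 0 ∅ {φ} ψ) :
    PrfN L 0 Γ Δ (boxN n ψ) := by
  induction n generalizing Γ Δ with
  | zero => exact h.cut h'
  | succ n ih =>
    have hs := h.sentence.2
    exact h.intTrans (imp_of hs (ih (.self hs)))

theorem PrfN.box_and {n : ℕ} (h : PrfN L 0 Γ Δ (boxN n φ)) (h' : PrfN L 0 Γ Δ (boxN n ψ)) :
    PrfN L 0 Γ Δ (boxN n (.and φ ψ)) := by
  induction n generalizing Γ Δ with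
  | zero => exact h.andIntro h'
  | succ n ih =>
    have hs : (Formula.and (boxN n φ) (boxN n ψ)).Sentence := ⟨h.sentence.2, h'.sentence.2⟩
    have hh : PrfN L 0 ∅ {Formula.and (boxN n φ) (boxN n ψ)} _ := .hyp (by simp) hs
    exact (h.intAndIntro h').intTrans (imp_of hs (ih hh.andElimL hh.andElimR))

theorem PrfN.box_all {n : ℕ} (h : PrfN L 0 Γ Δ (.all (boxN n φ))) :
    PrfN L 0 Γ Δ (boxN n (.all φ)) := by
  induction n generalizing Γ Δ with
  | zero => exact h
  | succ n ih =>
    have h' := PrfN.intAllIntro sentence_top h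
    have hs := h'.sentence.2
    exact h'.intTrans (imp_of hs (ih (.self hs)))

theorem PrfN.box_mono {n m : ℕ} (hnm : n ≤ m) (h : PrfN L 0 Γ Δ (boxN n φ)) :
    PrfN L 0 Γ Δ (boxN m φ) := by
  induction hnm with
  | refl => exact h
  | step _ ih => exact .impIntro sentence_top (ih.weaken subset_rfl (Set.subset_insert _ _))

theorem PrfN.box_all_intro {n i : ℕ} (hΓ : FreshIn i Γ) (hφ : ¬ φ.OccC (Sum.inr i))
    (h : PrfN L 0 Γ ∅ (boxN n (subst0 φ (aconst L i)))) :
    PrfN L 0 Γ ∅ (boxN n (.all φ)) :=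
  box_all (.allIntro (i := i) subset_rfl subset_rfl hΓ (by simp [FreshIn])
    (mt occC_boxN.1 hφ) (by rwa [subst0_boxN]))

end Calculus

/-- `δ` is a finite conjunction of sentences from `Δ`. -/
inductive ConjOf (Δ : Set (Formula L)) : Formula L → Prop
  | top : ConjOf Δ .top
  | mem {φ} : φ ∈ Δ → φ.Sentence → ConjOf Δ φ
  | and {φ ψ} : ConjOf Δ φ → ConjOf Δ ψ → ConjOf Δ (.and φ ψ)

theorem ConjOf.sentence {Δ : Set (Formula L)} {δ : Formula L} (h : ConjOf Δ δ) :
    δ.Sentence := by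
  induction h with
  | top => trivial
  | mem _ h => exact h
  | and _ _ ih₁ ih₂ => exact ⟨ih₁, ih₂⟩

theorem ConjOf.mono {Δ Δ' : Set (Formula L)} {δ : Formula L} (hΔ : Δ ⊆ Δ') (h : ConjOf Δ δ) :
    ConjOf Δ' δ := by
  induction h with
  | top => exact .top
  | mem h hs => exact .mem (hΔ h) hs
  | and _ _ ih₁ ih₂ => exact .and ih₁ ih₂

theorem ConjOf.fresh {Δ : Set (Formula L.plus)} {δ : Formula L.plus} {i : ℕ} (hΔ : FreshIn i Δ)
    (h : ConjOf Δ δ) : ¬ δ.OccC (Sum.inr i) := by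
  induction h with
  | top => simp [Formula.OccC]
  | mem h _ => exact hΔ _ h
  | and _ _ ih₁ ih₂ => simpa [Formula.OccC] using ⟨ih₁, ih₂⟩

theorem ConjOf.prf {Δ : Set (Formula L.plus)} {δ : Formula L.plus} (h : ConjOf Δ δ) :
    PrfN L 0 ∅ Δ δ := by
  induction h with
  | top => exact .topIntro
  | mem h hs => exact .hyp (by simpa using h) hs
  | and _ _ ih₁ ih₂ => exact .andIntro ih₁ ih₂

theorem ConjOf.exists_of_insert {Δ : Set (Formula L.plus)} {φ δ : Formula L.plus}
    (hφ : φ.Sentence) (h : ConjOf (insert φ Δ) δ) :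
    ∃ δ', ConjOf Δ δ' ∧ PrfN L 0 ∅ {Formula.and δ' φ} δ := by
  induction h with
  | top => exact ⟨.top, .top, .topIntro⟩
  | @mem ψ h hs =>
    rcases h with rfl | h
    · exact ⟨.top, .top, .andElimR (φ := .top) (.hyp (by simp) ⟨trivial, hφ⟩)⟩
    · exact ⟨ψ, .mem h hs, .andElimL (ψ := φ) (.hyp (by simp) ⟨hs, hφ⟩)⟩
  | and _ _ ih₁ ih₂ =>
    obtain ⟨δ₁, hδ₁, h₁⟩ := ih₁
    obtain ⟨δ₂, hδ₂, h₂⟩ := ih₂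
    have hyp : PrfN L 0 ∅ {Formula.and (.and δ₁ δ₂) φ} (.and (.and δ₁ δ₂) φ) :=
      .hyp (by simp) ⟨⟨hδ₁.sentence, hδ₂.sentence⟩, hφ⟩
    exact ⟨_, hδ₁.and hδ₂, .andIntro
      ((hyp.andElimL.andElimL.andIntro hyp.andElimR).cut h₁)
      ((hyp.andElimL.andElimR.andIntro hyp.andElimR).cut h₂)⟩

/-- `NBQL_CD` proves `□ⁿ(δ → φ)` from `Γ` for some `n` and some finite conjunction `δ` of
sentences from `Δ`. -/
def BoxPrf (L : Signature) (Γ Δ : Set (Formula L.plus)) (φ : Formula L.plus) : Prop :=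
  ∃ n δ, ConjOf Δ δ ∧ PrfN L 0 Γ ∅ (boxN n (.imp δ φ))

namespace BoxPrf

variable {Γ Γ' Δ Δ' : Set (Formula L.plus)} {φ ψ χ : Formula L.plus}

theorem sentence (h : BoxPrf L Γ Δ φ) : φ.Sentence := by
  obtain ⟨n, δ, -, h⟩ := h
  exact (sentence_boxN.1 h.sentence).2

theorem of_prf (h : PrfN L 0 ∅ {.top} φ) : BoxPrf L Γ Δ φ :=
  ⟨0, .top, .top, .imp_of trivial h⟩

theorem weaken (hΓ : Γ ⊆ Γ') (hΔ : Δ ⊆ Δ') (h : BoxPrf L Γ Δ φ) : BoxPrf L Γ' Δ' φ := by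
  obtain ⟨n, δ, hδ, h⟩ := h
  exact ⟨n, δ, hδ.mono hΔ, h.weaken hΓ subset_rfl⟩

theorem map (h : BoxPrf L Γ Δ φ) (h' : PrfN L 0 ∅ {φ} ψ) : BoxPrf L Γ Δ ψ := by
  have hφ := h.sentence
  obtain ⟨n, δ, hδ, h⟩ := h
  exact ⟨n, δ, hδ, h.box_map ((PrfN.self (sentence_boxN.1 h.sentence)).intTrans (.imp_of hφ h'))⟩

theorem and (h₁ : BoxPrf L Γ Δ φ) (h₂ : BoxPrf L Γ Δ ψ) : BoxPrf L Γ Δ (.and φ ψ) := by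
  obtain ⟨n, δ, hδ, h₁⟩ := h₁
  obtain ⟨m, ε, hε, h₂⟩ := h₂
  have h := (h₁.box_mono (le_max_left n m)).box_and (h₂.box_mono (le_max_right n m))
  refine ⟨_, _, hδ.and hε, h.box_map ?_⟩
  have hyp := PrfN.self (sentence_boxN.1 h.sentence)
  have conj : PrfN L 0 ∅ {Formula.and δ ε} (.and δ ε) :=
    .hyp (by simp) (hδ.and hε).sentence
  exact ((PrfN.imp_of conj.sentence conj.andElimL).intTrans hyp.andElimL).intAndIntro
    ((PrfN.imp_of conj.sentence conj.andElimR).intTrans hyp.andElimR)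

theorem map₂ (h₁ : BoxPrf L Γ Δ φ) (h₂ : BoxPrf L Γ Δ ψ)
    (h : PrfN L 0 ∅ {φ, ψ} χ) : BoxPrf L Γ Δ χ := by
  refine (h₁.and h₂).map ?_
  have hyp : PrfN L 0 ∅ {Formula.and φ ψ} (.and φ ψ) :=
    .hyp (by simp) ⟨h₁.sentence, h₂.sentence⟩
  have h' : PrfN L 0 ∅ {φ, ψ, Formula.and φ ψ} χ :=
    h.weaken subset_rfl (by simp [Set.insert_subset_iff])
  have hφ : PrfN L 0 ∅ {Formula.and φ ψ} φ := hyp.andElimL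
  have hψ : PrfN L 0 ∅ {φ, Formula.and φ ψ} ψ :=
    hyp.andElimR.weaken subset_rfl (by simp)
  rw [Set.insert_comm] at h'
  have h'' := (PrfN.orIntroL hψ.sentence hψ).orElim h' h'
  exact (PrfN.orIntroL hφ.sentence hφ).orElim h'' h''

theorem discharge (hφ : φ.Sentence) (h : BoxPrf L Γ (insert φ Δ) ψ) :
    ∃ n δ, ConjOf Δ δ ∧ PrfN L 0 Γ ∅ (boxN n (.imp (.and δ φ) ψ)) := by
  obtain ⟨n, δ, hδ, h⟩ := h
  obtain ⟨δ', hδ', hp⟩ := hδ.exists_of_insert hφ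
  exact ⟨n, δ', hδ', h.box_map ((PrfN.imp_of (sentence_and.2 ⟨hδ'.sentence, hφ⟩) hp).intTrans
    (.self (sentence_boxN.1 h.sentence)))⟩

theorem impIntro (hφ : φ.Sentence) (h : BoxPrf L Γ (insert φ Δ) ψ) :
    BoxPrf L Γ Δ (.imp φ ψ) := by
  obtain ⟨n, δ, hδ, h⟩ := h.discharge hφ
  have hs := sentence_boxN.1 h.sentence
  refine ⟨n, δ, hδ, h.box_map (.impIntro hδ.sentence ?_)⟩
  exact .intTrans (ψ := .and δ φ) (.impIntro hφ (.andIntro (.hyp (by simp) hδ.sentence)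
    (.hyp (by simp) hφ))) (.hyp (by simp) hs)

theorem impElim (h₁ : BoxPrf L Γ Δ φ) (h₂ : BoxPrf L Γ ∅ (.imp φ ψ)) : BoxPrf L Γ Δ ψ := by
  obtain ⟨n, δ, hδ, h₁⟩ := h₁
  obtain ⟨m, ε, hε, h₂⟩ := h₂
  have h₂ : PrfN L 0 Γ ∅ (boxN (m + 1) (.imp φ ψ)) := by
    rw [boxN_succ']
    exact h₂.box_map ((PrfN.impIntro (φ := .top) trivial
      (hε.prf.weaken subset_rfl (Set.empty_subset _))).intTrans
      (.self (sentence_boxN.1 h₂.sentence)))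
  have h := (h₁.box_mono (le_max_left n (m + 1))).box_and (h₂.box_mono (le_max_right n (m + 1)))
  have hyp := PrfN.self (sentence_boxN.1 h.sentence)
  exact ⟨_, δ, hδ, h.box_map (hyp.andElimL.intTrans hyp.andElimR)⟩

theorem orElim (h : BoxPrf L Γ Δ (.or φ ψ)) (h₁ : BoxPrf L Γ (insert φ Δ) χ)
    (h₂ : BoxPrf L Γ (insert ψ Δ) χ) : BoxPrf L Γ Δ χ := by
  have hs := h.sentence
  obtain ⟨n, δ, hδ, h⟩ := h
  obtain ⟨n₁, δ₁, hδ₁, h₁⟩ := h₁.discharge hs.1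
  obtain ⟨n₂, δ₂, hδ₂, h₂⟩ := h₂.discharge hs.2
  have hc := hδ.and (hδ₁.and hδ₂)
  have hb := (h.box_mono (le_max_left n (max n₁ n₂))).box_and
    ((h₁.box_mono (le_max_of_le_right (le_max_left n₁ n₂))).box_and
      (h₂.box_mono (le_max_of_le_right (le_max_right n₁ n₂))))
  refine ⟨_, _, hc, hb.box_map ?_⟩
  have hyp := PrfN.self (sentence_boxN.1 hb.sentence)
  have conj : PrfN L 0 ∅ {Formula.and δ (.and δ₁ δ₂)} (.and δ (.and δ₁ δ₂)) :=
    .hyp (by simp) hc.sentence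
  have both : PrfN L 0 ∅ {Formula.and (.and δ₁ δ₂) (.or φ ψ)} (.and (.and δ₁ δ₂) (.or φ ψ)) :=
    .hyp (by simp) ⟨⟨hδ₁.sentence, hδ₂.sentence⟩, hs⟩
  have distrib : PrfN L 0 ∅ {Formula.and (.and δ₁ δ₂) (.or φ ψ)}
      (.or (.and δ₁ φ) (.and δ₂ ψ)) := by
    have both' (θ) := both.weaken subset_rfl (Set.subset_insert θ _)
    exact both.andElimR.orElim
      (.orIntroL ⟨hδ₂.sentence, hs.2⟩ ((both' φ).andElimL.andElimL.andIntro (.hyp (by simp) hs.1)))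
      (.orIntroR ⟨hδ₁.sentence, hs.1⟩ ((both' ψ).andElimL.andElimR.andIntro (.hyp (by simp) hs.2)))
  exact (((PrfN.imp_of hc.sentence conj.andElimR).intAndIntro
    ((PrfN.imp_of hc.sentence conj.andElimL).intTrans hyp.andElimL)).intTrans
      (.imp_of both.sentence distrib)).intTrans
        (hyp.andElimR.andElimL.intOrElim hyp.andElimR.andElimR)

theorem allIntro {i : ℕ} (hΓ : FreshIn i Γ) (hΔ : FreshIn i Δ) (hφ : ¬ φ.OccC (Sum.inr i))
    (h : BoxPrf L Γ Δ (subst0 φ (aconst L i))) : BoxPrf L Γ Δ (.all φ) := by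
  obtain ⟨n, δ, hδ, h⟩ := h
  have ha : PrfN L 0 Γ ∅ (boxN n (.all (.imp δ φ))) := by
    refine .box_all_intro hΓ (by simpa [Formula.OccC] using ⟨hδ.fresh hΔ, hφ⟩) ?_
    rw [← subst0_eq_self hδ.sentence (aconst L i)] at h
    exact h
  exact ⟨n, δ, hδ, ha.box_map (.intAllIntro hδ.sentence
    (.self (sentence_boxN.1 ha.sentence)))⟩

theorem exElim {i : ℕ} (hΓ : Γ' ⊆ Γ) (hΔ : Δ' ⊆ Δ) (hfΓ : FreshIn i Γ') (hfΔ : FreshIn i Δ')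
    (hφ : ¬ φ.OccC (Sum.inr i)) (hψ : ¬ ψ.OccC (Sum.inr i)) (h : BoxPrf L Γ Δ (.ex φ))
    (h' : BoxPrf L Γ' (insert (subst0 φ (aconst L i)) Δ') ψ) : BoxPrf L Γ Δ ψ := by
  have hs := h.sentence
  have hsψ := h'.sentence
  have hsi : (subst0 φ (aconst L i)).Sentence := (subst0_sentence (aconst_closed i)).2 hs
  obtain ⟨n, δ, hδ, h⟩ := h
  obtain ⟨m, ε, hε, h'⟩ := h'.discharge hsi
  have subst_and : subst0 (.and ε φ) (aconst L i) = .and ε (subst0 φ (aconst L i)) :=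
    congrArg (Formula.and · _) (subst0_eq_self hε.sentence _)
  have ha : PrfN L 0 Γ' ∅ (boxN m (.all (.imp (.and ε φ) ψ))) := by
    refine .box_all_intro hfΓ
      (by simpa [Formula.OccC, hφ, hψ] using hε.fresh hfΔ) ?_
    rw [← subst_and, ← subst0_eq_self hsψ (aconst L i)] at h'
    exact h'
  have he : PrfN L 0 Γ ∅ (boxN m (.imp (.ex (.and ε φ)) ψ)) :=
    (ha.box_map (.intExElim hsψ (.self (sentence_boxN.1 ha.sentence)))).weaken
      hΓ subset_rfl
  have hse : (Formula.ex (.and ε φ)).Sentence := (sentence_boxN.1 he.sentence).1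
  have hc := hδ.and (hε.mono hΔ)
  have hb := (h.box_mono (le_max_left n m)).box_and (he.box_mono (le_max_right n m))
  refine ⟨_, _, hc, hb.box_map ?_⟩
  have hyp := PrfN.self (sentence_boxN.1 hb.sentence)
  have conj : PrfN L 0 ∅ {Formula.and δ ε} (.and δ ε) := .hyp (by simp) hc.sentence
  have both : PrfN L 0 ∅ {Formula.and ε (.ex φ)} (.and ε (.ex φ)) :=
    .hyp (by simp) ⟨hε.sentence, hs⟩
  have distrib : PrfN L 0 ∅ {Formula.and ε (.ex φ)} (.ex (.and ε φ)) := by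
    refine .exElim (i := i) subset_rfl subset_rfl (by simp [FreshIn]) ?_ hφ ?_ both.andElimR ?_
    · simpa [FreshIn, Formula.OccC, hφ] using hε.fresh hfΔ
    · simpa [Formula.OccC, hφ] using hε.fresh hfΔ
    · refine .exIntro (aconst_closed i) hse ?_
      rw [subst_and]
      exact (both.weaken subset_rfl (Set.subset_insert _ _)).andElimL.andIntro
        (.hyp (by simp) hsi)
  exact (((PrfN.imp_of hc.sentence conj.andElimR).intAndIntro
    ((PrfN.imp_of hc.sentence conj.andElimL).intTrans hyp.andElimL)).intTrans
      (.imp_of both.sentence distrib)).intTrans hyp.andElimR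

end BoxPrf

theorem Prf.boxPrf {Γ Δ : Set (Formula L.plus)} {φ : Formula L.plus} (h : Prf L Γ Δ φ) :
    BoxPrf L Γ Δ φ := by
  induction h with
  | @hyp Γ Δ φ h hs =>
    rcases h with h | h
    · exact ⟨0, .top, .top, .impIntro trivial (.hyp (.inl h) hs)⟩
    · exact ⟨0, φ, .mem h hs, .imp_of hs (.self hs)⟩
  | weaken hΓ hΔ _ ih => exact ih.weaken hΓ hΔ
  | topIntro => exact .of_prf .topIntro
  | botElim hs _ ih => exact ih.map (.botElim hs (.self trivial))
  | andIntro _ _ ih₁ ih₂ => exact ih₁.and ih₂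
  | andElimL _ ih => exact ih.map (PrfN.self ih.sentence).andElimL
  | andElimR _ ih => exact ih.map (PrfN.self ih.sentence).andElimR
  | orIntroL hs _ ih => exact ih.map (.orIntroL hs (.self ih.sentence))
  | orIntroR hs _ ih => exact ih.map (.orIntroR hs (.self ih.sentence))
  | orElim _ _ _ ih ih₁ ih₂ => exact ih.orElim ih₁ ih₂
  | impIntro hs _ ih => exact ih.impIntro hs
  | impElim _ _ ih₁ ih₂ => exact ih₁.impElim ih₂
  | intTrans _ _ ih₁ ih₂ =>
    exact ih₁.map₂ ih₂ (.intTrans (.hyp (by simp) ih₁.sentence) (.hyp (by simp) ih₂.sentence))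
  | intAndIntro _ _ ih₁ ih₂ =>
    exact ih₁.map₂ ih₂ (.intAndIntro (.hyp (by simp) ih₁.sentence) (.hyp (by simp) ih₂.sentence))
  | intOrElim _ _ ih₁ ih₂ =>
    exact ih₁.map₂ ih₂ (.intOrElim (.hyp (by simp) ih₁.sentence) (.hyp (by simp) ih₂.sentence))
  | intAllIntro hs _ ih => exact ih.map (.intAllIntro hs (.self ih.sentence))
  | intExElim hs _ ih => exact ih.map (.intExElim hs (.self ih.sentence))
  | allIntro hΓ hΔ hfΓ hfΔ hφ _ ih => exact (ih.allIntro hfΓ hfΔ hφ).weaken hΓ hΔ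
  | allElim ht _ ih => exact ih.map (.allElim ht (.self ih.sentence))
  | cd hs _ ih => exact ih.map (.cd hs (.self ih.sentence))
  | exIntro ht hs _ ih => exact ih.map (.exIntro ht hs (.self ih.sentence))
  | exElim hΓ hΔ hfΓ hfΔ hφ hψ _ _ ih ih' => exact ih.exElim hΓ hΔ hfΓ hfΔ hφ hψ ih'

end Reduction

/-- **Reduction** (Theorem 4): if `Γ ⊢ φ` (in `NBQL_CD^r`) then `Γ ⊢_{[-1]} □ⁿφ`
(in `NBQL_CD`) for some `n`. -/
theorem reduction {L : Signature} (Γ : Set (Formula L.plus)) (φ : Formula L.plus)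
    (hΓ : ∀ ψ ∈ Γ, ψ.Sentence) (hφ : φ.Sentence)
    (h : Prv L Γ φ) : ∃ n : ℕ, PrvB L Γ (boxN n φ) := by
  obtain ⟨n, δ, hδ, hp⟩ := Prf.boxPrf h
  refine ⟨n + 1, ?_⟩
  rw [boxN_succ']
  exact hp.box_map ((PrfN.impIntro sentence_top
    (hδ.prf.weaken subset_rfl (Set.empty_subset _))).intTrans
    (.self (sentence_boxN.1 hp.sentence)))

end BQL
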